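/- Let T be a plane tree all of whose internal nodes have arity at least 2, and define the polynomial F_T ∈ ℚ[t] recursively: F_T = 1 if T is a single leaf, and if the root of T has subtrees T₁,…,T_k (k ≥ 2, in this order), then F_T is the unique polynomial with F_T(0) = 0 and F_T(t+1) − F_T(t) = F_{T₁}(t)·F_{T₂}(t)⋯F_{T_k}(t). Write F_T in the binomial basis as F_T(t) = ∑_{k ≥ 0} c_k · binom(t, k) with c_k ∈ ℚ. Then for every k, c_k is the number of packed words u with maximal letter k such that 𝒯(u) = T; in particular all c_k are nonnegative integers. -/

import Mathlib

open Polynomial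

/-- The packed word of `w`: each occurrence of the `i`-th smallest letter occurring in `w`
is replaced by `i` (so the letter `a` becomes the number of distinct letters of `w`
that are `≤ a`). -/
def pack (w : List ℕ) : List ℕ :=
  w.map fun a => w.dedup.countP fun x => x ≤ a

/-- The maximal letter of a word (`0` for the empty word). -/
def maxL (w : List ℕ) : ℕ := w.foldr max 0

/-- A finset containing all lists of length `n` with entries `≤ n`; in particular it
contains all packed words of length `n`. -/
def allLists (n : ℕ) : Finset (List ℕ) :=
  Finset.image (fun f : Fin n → Fin (n + 1) => List.ofFn fun i => (f i : ℕ)) Finset.univ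

/-- The generalized binomial coefficient `binom(t, k) = t(t-1)⋯(t-k+1)/k!`
as a polynomial in `t`. -/
noncomputable def binomPoly (k : ℕ) : Polynomial ℚ :=
  ((Nat.factorial k : ℚ))⁻¹ • descPochhammer ℚ k

/-- Plane trees: a leaf, or a root carrying an ordered list of subtrees. -/
inductive PT : Type
  | leaf : PT
  | node : List PT → PT

mutual
/-- The number of leaves of a plane tree. -/
def PT.numLeaves : PT → ℕ
  | PT.leaf => 1
  | PT.node ts => PT.numLeavesList ts

/-- The total number of leaves of a list of plane trees. -/
def PT.numLeavesList : List PT → ℕ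
  | [] => 0
  | t :: ts => PT.numLeaves t + PT.numLeavesList ts
end

/-- `TreeRel w T` means that the plane tree `𝒯(w)` associated to the word `w` is `T`:
the empty word gives a leaf, and a nonempty word `w = v₁ m v₂ m ⋯ m v_k` (where `m` is
its maximal letter, occurring `k-1` times, so all other letters are `< m`) gives the
tree grafting `𝒯(v₁), …, 𝒯(v_k)` (in this order) on a common root. -/
inductive TreeRel : List ℕ → PT → Prop
  | leaf : TreeRel [] PT.leaf
  | node (vs : List (List ℕ)) (m : ℕ) (ts : List PT) :
      2 ≤ vs.length →
      (∀ v ∈ vs, ∀ x ∈ v, x < m) →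
      List.Forall₂ TreeRel vs ts →
      TreeRel (List.intercalate [m] vs) (PT.node ts)

/-- `FRel T F` means that `F = F_T`: `F = 1` when `T` is a single leaf, and when the root
of `T` carries the subtrees `T₁, …, T_k` (with `k ≥ 2`), `F` is the unique polynomial
with `F(0) = 0` and `F(t+1) - F(t) = F_{T₁}(t) ⋯ F_{T_k}(t)`. -/
inductive FRel : PT → Polynomial ℚ → Prop
  | leaf : FRel PT.leaf 1
  | node (ts : List PT) (ps : List (Polynomial ℚ)) (F : Polynomial ℚ) :
      2 ≤ ts.length →
      List.Forall₂ FRel ts ps →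
      F.eval 0 = 0 →
      F.comp (Polynomial.X + 1) - F = ps.prod →
      FRel (PT.node ts) F

open Classical in
/-- The finset of packed words `u` with maximal letter `k` whose associated plane tree
`𝒯(u)` is `T` (such a word has length `numLeaves T - 1`). -/
noncomputable def packedWithTree (T : PT) (k : ℕ) : Finset (List ℕ) :=
  (allLists (T.numLeaves - 1)).filter fun w => pack w = w ∧ maxL w = k ∧ TreeRel w T

theorem PT.induction_mem {P : PT → Prop} (leaf : P PT.leaf)
    (node : ∀ ts, (∀ t ∈ ts, P t) → P (PT.node ts)) : ∀ T, P T
  | PT.leaf => leaf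
  | PT.node ts => node ts fun t _ => PT.induction_mem leaf node t
termination_by T => sizeOf T
decreasing_by
  have := List.sizeOf_lt_of_mem ‹t ∈ ts›
  simp
  omega

section Intercalate

variable {α β : Type*}

theorem List.mem_intercalate_singleton {m x : α} {vs : List (List α)} :
    x ∈ List.intercalate [m] vs ↔ (∃ v ∈ vs, x ∈ v) ∨ (x = m ∧ 2 ≤ vs.length) := by
  induction vs with
  | nil => simp
  | cons v vs ih =>
    cases vs with
    | nil => simp
    | cons u us =>
      rw [List.intercalate_cons_cons, List.mem_append, List.mem_append, ih]
      simp only [List.mem_cons, List.not_mem_nil, or_false, List.length_cons, exists_eq_or_imp]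
      grind

theorem List.map_intercalate_singleton (f : α → β) (m : α) (vs : List (List α)) :
    (List.intercalate [m] vs).map f = List.intercalate [f m] (vs.map (List.map f)) := by
  induction vs with
  | nil => simp
  | cons v vs ih =>
    cases vs with
    | nil => simp
    | cons u us =>
      rw [List.intercalate_cons_cons, List.map_append, List.map_append, ih]
      simp [List.intercalate_cons_cons]

theorem List.forall₂_left_of_mem {R : α → β → Prop} {P : α → Prop} {as : List α} {bs : List β}
    (h : List.Forall₂ R as bs) (hP : ∀ b ∈ bs, ∀ a, R a b → P a) : ∀ a ∈ as, P a := by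
  induction h with
  | nil => simp
  | cons hab _ ih =>
    simp only [List.mem_cons, forall_eq_or_imp] at hP ⊢
    exact ⟨hP.1 _ hab, ih hP.2⟩

end Intercalate

theorem TreeRel.length_add_one {T : PT} : ∀ {w : List ℕ}, TreeRel w T →
    w.length + 1 = T.numLeaves := by
  induction T using PT.induction_mem with
  | leaf =>
    intro w h
    cases h
    simp [PT.numLeaves]
  | node ts ih =>
    intro w h
    cases h with
    | node vs m _ h2 hlt hall =>
      have hne : vs ≠ [] := by
        rintro rfl
        simp at h2
      clear h2 hlt
      rw [PT.numLeaves]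
      induction hall with
      | nil => exact absurd rfl hne
      | @cons v t vs ts hvt hall ihl =>
        have hv := ih t (by simp) hvt
        cases hall with
        | nil => simp [PT.numLeavesList, hv]
        | cons hvt' hall' =>
          have := ihl (fun t' ht' => ih t' (List.mem_cons_of_mem _ ht')) (by simp)
          rw [List.intercalate_cons_cons, PT.numLeavesList]
          simp only [List.length_append, List.length_singleton] at this ⊢
          omega

theorem TreeRel.map {T : PT} : ∀ {w : List ℕ} {f : ℕ → ℕ}, TreeRel w T →
    StrictMonoOn f {x | x ∈ w} → TreeRel (w.map f) T := by
  induction T using PT.induction_mem with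
  | leaf =>
    intro w f h _
    cases h
    exact TreeRel.leaf
  | node ts ih =>
    intro w f h hf
    cases h with
    | node vs m _ h2 hlt hall =>
      rw [List.map_intercalate_singleton]
      have hmem : ∀ v ∈ vs, ∀ x ∈ v, x ∈ List.intercalate [m] vs := fun v hv x hx =>
        List.mem_intercalate_singleton.2 (Or.inl ⟨v, hv, hx⟩)
      have hm : m ∈ List.intercalate [m] vs :=
        List.mem_intercalate_singleton.2 (Or.inr ⟨rfl, h2⟩)
      refine TreeRel.node _ _ _ (by simpa using h2) ?_ ?_
      · simp only [List.mem_map, forall_exists_index, and_imp]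
        rintro _ v hv rfl
        simp only [List.mem_map, forall_exists_index, and_imp]
        rintro _ x hx rfl
        exact hf (hmem v hv x hx) hm (hlt v hv x hx)
      · rw [List.forall₂_map_left_iff]
        have hmono : ∀ v ∈ vs, StrictMonoOn f {x | x ∈ v} := fun v hv =>
          hf.mono fun x hx => hmem v hv x hx
        clear h2 hlt hf hmem hm
        induction hall with
        | nil => exact List.Forall₂.nil
        | cons hvt _ ihl =>
          exact List.Forall₂.cons (ih _ (by simp) hvt (hmono _ (by simp)))
            (ihl (fun t ht => ih t (List.mem_cons_of_mem _ ht))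
              fun v hv => hmono v (List.mem_cons_of_mem _ hv))

/-- Words with tree `T` whose letters are all `< n`. -/
def boundedWords (T : PT) (n : ℕ) : Set (List ℕ) :=
  {w | TreeRel w T ∧ ∀ x ∈ w, x < n}

/-- Words with tree `T` whose set of letters is exactly `S`. -/
def wordsOn (T : PT) (S : Finset ℕ) : Set (List ℕ) :=
  {w | TreeRel w T ∧ w.toFinset = S}

theorem finite_boundedWords (T : PT) (n : ℕ) : (boundedWords T n).Finite := by
  refine ((List.finite_length_eq (Fin n) (T.numLeaves - 1)).image (List.map Fin.val)).subset ?_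
  rintro w ⟨hT, hw⟩
  have hlen := hT.length_add_one
  refine ⟨w.pmap (fun x hx => ⟨x, hx⟩) hw, ?_, ?_⟩
  · simp only [Set.mem_ofPred_eq, List.length_pmap]
    omega
  · simp [List.map_pmap]

theorem wordsOn_subset_boundedWords {T : PT} {S : Finset ℕ} {n : ℕ} (h : S ⊆ Finset.range n) :
    wordsOn T S ⊆ boundedWords T n := by
  rintro w ⟨hT, rfl⟩
  exact ⟨hT, fun x hx => Finset.mem_range.1 (h (List.mem_toFinset.2 hx))⟩

theorem finite_wordsOn (T : PT) (S : Finset ℕ) : (wordsOn T S).Finite :=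
  (finite_boundedWords T (S.sup id + 1)).subset <| wordsOn_subset_boundedWords fun _ hx =>
    Finset.mem_range.2 (Nat.lt_succ_of_le (Finset.le_sup (f := id) hx))

theorem ncard_wordsOn_le {T : PT} {S S' : Finset ℕ} (e : S ≃o S') :
    (wordsOn T S).ncard ≤ (wordsOn T S').ncard := by
  set f : ℕ → ℕ := fun a => if h : a ∈ S then (e ⟨a, h⟩ : ℕ) else 0 with hf
  have hfS : ∀ a (h : a ∈ S), f a = e ⟨a, h⟩ := fun a h => by simp [hf, h]
  have hmono : StrictMonoOn f S := by
    intro a ha b hb hab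
    rw [hfS a ha, hfS b hb]
    exact e.strictMono (show (⟨a, ha⟩ : S) < ⟨b, hb⟩ from hab)
  have himage : S.image f = S' := by
    ext y
    rw [Finset.mem_image]
    constructor
    · rintro ⟨a, ha, rfl⟩
      rw [hfS a ha]
      exact (e ⟨a, ha⟩).2
    · intro hy
      refine ⟨e.symm ⟨y, hy⟩, (e.symm ⟨y, hy⟩).2, ?_⟩
      rw [hfS _ (e.symm ⟨y, hy⟩).2]
      simp
  refine Set.ncard_le_ncard_of_injOn (List.map f) ?_ ?_ (finite_wordsOn T S')
  · rintro w ⟨hT, rfl⟩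
    refine ⟨hT.map (hmono.mono fun x hx => by simpa using hx), ?_⟩
    rw [← himage]
    ext y
    simp
  · rintro w ⟨-, hw⟩ w' ⟨-, hw'⟩ h
    have hmem : ∀ {u : List ℕ}, u.toFinset = S → ∀ x ∈ u, x ∈ (S : Set ℕ) := by
      rintro u rfl x hx
      simpa using hx
    have hleft : ∀ {u : List ℕ}, u.toFinset = S →
        (u.map f).map (Function.invFunOn f S) = u := by
      intro u hu
      rw [List.map_map]
      exact (List.map_congr_left fun x hx =>
        hmono.injOn.leftInvOn_invFunOn (hmem hu x hx)).trans (List.map_id u)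
    rw [← hleft hw, ← hleft hw', h]

theorem ncard_wordsOn_congr {T : PT} {S S' : Finset ℕ} (h : S.card = S'.card) :
    (wordsOn T S).ncard = (wordsOn T S').ncard :=
  have e : S ≃o S' := (S.orderIsoOfFin h).symm.trans (S'.orderIsoOfFin rfl)
  le_antisymm (ncard_wordsOn_le e) (ncard_wordsOn_le e.symm)

theorem ncard_boundedWords_eq_sum (T : PT) (n : ℕ) :
    (boundedWords T n).ncard =
      ∑ k ∈ Finset.range (n + 1), n.choose k * (wordsOn T (Finset.Icc 1 k)).ncard := by
  classical
  have key : (boundedWords T n).ncard =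
      ∑ S ∈ (Finset.range n).powerset, (wordsOn T S).ncard := by
    rw [Set.ncard_eq_toFinset_card _ (finite_boundedWords T n),
      Finset.card_eq_sum_card_fiberwise (f := List.toFinset) (t := (Finset.range n).powerset)]
    · refine Finset.sum_congr rfl fun S hS => ?_
      rw [← Set.ncard_coe_finset]
      congr 1
      ext w
      simp only [Finset.coe_filter, Set.Finite.mem_toFinset, Set.mem_ofPred_eq]
      exact ⟨fun h => ⟨h.1.1, h.2⟩, fun h =>
        ⟨wordsOn_subset_boundedWords (Finset.mem_powerset.1 hS) h, h.2⟩⟩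
    · intro w hw
      have hw' : w ∈ boundedWords T n := by simpa using hw
      simp only [Finset.coe_powerset, Set.mem_preimage, Set.mem_powerset_iff]
      intro x hx
      simpa using hw'.2 x (by simpa using hx)
  rw [key, Finset.sum_congr rfl fun S _ => ncard_wordsOn_congr (T := T)
    (S' := Finset.Icc 1 S.card) (by simp)]
  simpa using Finset.sum_powerset_apply_card (x := Finset.range n)
    fun k => (wordsOn T (Finset.Icc 1 k)).ncard

theorem ncard_forall₂_eq_prod {α β : Type*} (R : α → β → Prop) (bs : List β) :
    {as : List α | List.Forall₂ R as bs}.ncard = (bs.map fun b => {a | R a b}.ncard).prod := by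
  induction bs with
  | nil => simp
  | cons b bs ih =>
    have : {as : List α | List.Forall₂ R as (b :: bs)} =
        (fun p : α × List α => p.1 :: p.2) '' ({a | R a b} ×ˢ {as | List.Forall₂ R as bs}) := by
      ext as
      simp only [Set.mem_ofPred_eq, List.forall₂_cons_right_iff, Set.mem_image, Set.mem_prod,
        Prod.exists]
      constructor
      · rintro ⟨a, as, h, h', rfl⟩
        exact ⟨a, as, ⟨h, h'⟩, rfl⟩
      · rintro ⟨a, as, ⟨h, h'⟩, rfl⟩
        exact ⟨a, as, h, h', rfl⟩
    rw [this, Set.ncard_image_of_injective, Set.ncard_prod, ih, List.map_cons, List.prod_cons]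
    rintro ⟨a, as⟩ ⟨a', as'⟩ h
    simpa using h

theorem boundedWords_leaf (n : ℕ) : boundedWords PT.leaf n = {[]} := by
  ext w
  constructor
  · rintro ⟨h, -⟩
    cases h
    rfl
  · rintro rfl
    exact ⟨TreeRel.leaf, by simp⟩

theorem boundedWords_node_zero (ts : List PT) : boundedWords (PT.node ts) 0 = ∅ := by
  ext w
  simp only [Set.mem_empty_iff_false, iff_false]
  rintro ⟨h, hw⟩
  cases h with
  | node vs m _ h2 _ _ =>
    exact absurd (hw m (List.mem_intercalate_singleton.2 (Or.inr ⟨rfl, h2⟩))) (by omega)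

theorem boundedWords_node_succ {ts : List PT} (hts : 2 ≤ ts.length) (n : ℕ) :
    boundedWords (PT.node ts) (n + 1) = boundedWords (PT.node ts) n ∪
      List.intercalate [n] ''
        {vs | List.Forall₂ (fun v t => v ∈ boundedWords t n) vs ts} := by
  ext w
  constructor
  · rintro ⟨h, hw⟩
    have h' := h
    cases h with
    | node vs m _ h2 hlt hall =>
      have hm := hw m (List.mem_intercalate_singleton.2 (Or.inr ⟨rfl, h2⟩))
      rcases Nat.lt_succ_iff_lt_or_eq.1 hm with hm | rfl
      · refine Or.inl ⟨h', fun x hx => ?_⟩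
        rcases List.mem_intercalate_singleton.1 hx with ⟨v, hv, hx⟩ | ⟨rfl, -⟩
        · exact (hlt v hv x hx).trans hm
        · exact hm
      · refine Or.inr ⟨vs, ?_, rfl⟩
        clear hw h2 h' hm hts
        induction hall with
        | nil => exact List.Forall₂.nil
        | cons hvt _ ih =>
          exact List.Forall₂.cons ⟨hvt, hlt _ (by simp)⟩
            (ih fun v hv => hlt v (List.mem_cons_of_mem _ hv))
  · rintro (⟨h, hw⟩ | ⟨vs, hvs, rfl⟩)
    · exact ⟨h, fun x hx => (hw x hx).trans n.lt_succ_self⟩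
    · have hlen := List.Forall₂.length_eq hvs
      have hlt : ∀ v ∈ vs, ∀ x ∈ v, x < n :=
        List.forall₂_left_of_mem hvs fun _ _ _ h => h.2
      refine ⟨TreeRel.node vs n ts (by omega) hlt (hvs.imp fun _ _ h => h.1), fun x hx => ?_⟩
      rcases List.mem_intercalate_singleton.1 hx with ⟨v, hv, hx⟩ | ⟨rfl, -⟩
      · exact (hlt v hv x hx).trans n.lt_succ_self
      · exact Nat.lt_succ_self _

theorem ncard_boundedWords_node_succ {ts : List PT} (hts : 2 ≤ ts.length) (n : ℕ) :
    (boundedWords (PT.node ts) (n + 1)).ncard = (boundedWords (PT.node ts) n).ncard +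
      (ts.map fun t => (boundedWords t n).ncard).prod := by
  have hsub := boundedWords_node_succ hts n
  have hfin := finite_boundedWords (PT.node ts) (n + 1)
  rw [hsub] at hfin
  have hlt : ∀ vs, List.Forall₂ (fun v t => v ∈ boundedWords t n) vs ts →
      2 ≤ vs.length ∧ ∀ v ∈ vs, n ∉ v := fun vs hvs =>
    ⟨hvs.length_eq ▸ hts,
      List.forall₂_left_of_mem hvs fun _ _ _ h hn => (h.2 n hn).false⟩
  rw [hsub, Set.ncard_union_eq _ (hfin.subset Set.subset_union_left)
    (hfin.subset Set.subset_union_right), Set.InjOn.ncard_image, ncard_forall₂_eq_prod]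
  · rfl
  · intro vs hvs us hus h
    have hsplit : ∀ vs, List.Forall₂ (fun v t => v ∈ boundedWords t n) vs ts →
        (List.intercalate [n] vs).splitOn n = vs := fun vs hvs =>
      List.splitOn_intercalate n (hlt vs hvs).2 fun h0 => by simpa [h0] using (hlt vs hvs).1
    rw [← hsplit vs hvs, ← hsplit us hus, h]
  · rw [Set.disjoint_left]
    rintro _ ⟨-, hw⟩ ⟨vs, hvs, rfl⟩
    exact (hw n (List.mem_intercalate_singleton.2 (Or.inr ⟨rfl, (hlt vs hvs).1⟩))).false

theorem FRel.eval_natCast {T : PT} : ∀ {F : Polynomial ℚ}, FRel T F → ∀ n : ℕ,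
    F.eval (n : ℚ) = (boundedWords T n).ncard := by
  induction T using PT.induction_mem with
  | leaf =>
    intro F h n
    cases h
    simp [boundedWords_leaf]
  | node ts ih =>
    intro F h n
    cases h with
    | node _ ps _ h2 hall h0 hF =>
      induction n with
      | zero => simp [boundedWords_node_zero, h0]
      | succ n ihn =>
        have hprod : ps.prod.eval (n : ℚ) =
            ((ts.map fun t => (boundedWords t n).ncard).prod : ℕ) := by
          clear h2 hF ihn
          induction hall with
          | nil => simp
          | cons h _ ihl =>
            rw [List.prod_cons, eval_mul, ihl fun t ht => ih t (List.mem_cons_of_mem _ ht),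
              ih _ (by simp) h]
            simp
        have hstep := congrArg (Polynomial.eval (n : ℚ)) hF
        rw [eval_sub, eval_comp, ihn, hprod] at hstep
        rw [ncard_boundedWords_node_succ h2]
        simp only [eval_add, eval_X, eval_one] at hstep
        push_cast at hstep ⊢
        linarith

theorem binomPoly_eval_natCast (k n : ℕ) : (binomPoly k).eval (n : ℚ) = n.choose k := by
  rw [binomPoly, eval_smul, descPochhammer_eval_eq_descFactorial,
    Nat.descFactorial_eq_factorial_mul_choose, smul_eq_mul, Nat.cast_mul, ← mul_assoc,
    inv_mul_cancel₀ (by exact_mod_cast k.factorial_ne_zero), one_mul]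

theorem maxL_eq_sup (w : List ℕ) : maxL w = w.toFinset.sup id := by
  induction w with
  | nil => rfl
  | cons a w ih =>
    rw [List.toFinset_cons, Finset.sup_insert, ← ih]
    rfl

theorem countP_dedup_eq_card (w : List ℕ) (a : ℕ) :
    (w.dedup.countP fun x => x ≤ a) = (w.toFinset.filter (· ≤ a)).card := by
  rw [List.countP_eq_length_filter, ← List.toFinset_card_of_nodup (w.nodup_dedup.filter _),
    List.toFinset_filter]
  congr 1
  ext
  simp

theorem pack_eq_self_iff (w : List ℕ) :
    pack w = w ↔ ∀ a ∈ w, (w.toFinset.filter (· ≤ a)).card = a := by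
  rw [pack]
  conv_lhs => rhs; rw [← List.map_id w]
  rw [List.map_inj_left]
  simp [countP_dedup_eq_card]

theorem sup_Icc_one (k : ℕ) : (Finset.Icc 1 k).sup id = k := by
  refine le_antisymm (Finset.sup_le fun x hx => (Finset.mem_Icc.1 hx).2) ?_
  rcases k.eq_zero_or_pos with rfl | hk
  · simp
  · exact Finset.le_sup (f := id) (Finset.mem_Icc.2 ⟨hk, le_rfl⟩)

theorem packed_iff_toFinset_eq (w : List ℕ) (k : ℕ) :
    (pack w = w ∧ maxL w = k) ↔ w.toFinset = Finset.Icc 1 k := by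
  rw [pack_eq_self_iff, maxL_eq_sup]
  constructor
  · rintro ⟨h, rfl⟩
    have hS : w.toFinset = Finset.Icc 1 w.toFinset.card := by
      refine Finset.eq_of_subset_of_card_le (fun a ha => ?_) (by simp)
      have hcard := h a (List.mem_toFinset.1 ha)
      refine Finset.mem_Icc.2 ⟨?_, ?_⟩
      · rw [← hcard]
        exact Finset.card_pos.2 ⟨a, Finset.mem_filter.2 ⟨ha, le_rfl⟩⟩
      · exact hcard.symm.le.trans (Finset.card_filter_le _ _)
    rw [hS, sup_Icc_one]
  · intro h
    rw [h, sup_Icc_one]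
    refine ⟨fun a ha => ?_, rfl⟩
    have ha' : a ∈ Finset.Icc 1 k := h ▸ List.mem_toFinset.2 ha
    have : (Finset.Icc 1 k).filter (· ≤ a) = Finset.Icc 1 a := by
      ext x
      simp only [Finset.mem_filter, Finset.mem_Icc] at ha' ⊢
      omega
    simp [this]

theorem mem_allLists {w : List ℕ} (h : ∀ x ∈ w, x ≤ w.length) : w ∈ allLists w.length := by
  refine Finset.mem_image.2
    ⟨fun i => ⟨w.get i, Nat.lt_succ_of_le (h _ (w.get_mem i))⟩, Finset.mem_univ _, ?_⟩
  simp

theorem coe_packedWithTree (T : PT) (k : ℕ) :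
    (packedWithTree T k : Set (List ℕ)) = wordsOn T (Finset.Icc 1 k) := by
  classical
  ext w
  rw [packedWithTree, Finset.mem_coe, Finset.mem_filter, ← and_assoc (a := pack w = w),
    packed_iff_toFinset_eq]
  constructor
  · rintro ⟨-, hw, hT⟩
    exact ⟨hT, hw⟩
  · rintro ⟨hT, hw⟩
    refine ⟨?_, hw, hT⟩
    rw [← hT.length_add_one, Nat.add_sub_cancel]
    refine mem_allLists fun x hx => ?_
    have hk : k ≤ w.length := by
      simpa [hw] using w.toFinset_card_le
    have hx' : x ∈ Finset.Icc 1 k := hw ▸ List.mem_toFinset.2 hx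
    exact (Finset.mem_Icc.1 hx').2.trans hk

/-- Binomial inversion, in the form of uniqueness of coefficients. -/
theorem eq_of_sum_choose_mul_eq {a b : ℕ → ℚ}
    (h : ∀ n : ℕ, ∑ k ∈ Finset.range (n + 1), (n.choose k : ℚ) * a k =
      ∑ k ∈ Finset.range (n + 1), (n.choose k : ℚ) * b k) (n : ℕ) : a n = b n := by
  induction n using Nat.strong_induction_on with
  | _ n ih =>
    have hn := h n
    rw [Finset.sum_range_succ, Finset.sum_range_succ, Finset.sum_congr rfl fun k hk => by
      rw [ih k (Finset.mem_range.1 hk)]] at hn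
    simpa using hn

/-- **The coefficients of `F_T` in the binomial basis count packed words**: if `T` is a
plane tree all of whose internal nodes have arity `≥ 2` and
`F_T = ∑_k c_k · binom(t, k)`, then `c_k` is the number of packed words `u` with maximal
letter `k` such that `𝒯(u) = T`. -/
theorem coeffs_count_packed_words (T : PT) (F : Polynomial ℚ) (hF : FRel T F)
    (c : ℕ → ℚ) (N : ℕ)
    (hFc : F = ∑ k ∈ Finset.range N, c k • binomPoly k)
    (hc0 : ∀ k, N ≤ k → c k = 0) :
    ∀ k, c k = ((packedWithTree T k).card : ℚ) := by
  refine eq_of_sum_choose_mul_eq fun n => ?_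
  have hcount := hF.eval_natCast n
  rw [ncard_boundedWords_eq_sum, hFc, eval_finsetSum] at hcount
  simp only [eval_smul, binomPoly_eval_natCast, smul_eq_mul, ← coe_packedWithTree,
    Set.ncard_coe_finset] at hcount
  push_cast at hcount
  rw [← hcount]
  have hL : ∑ k ∈ Finset.range (n + 1), (n.choose k : ℚ) * c k =
      ∑ k ∈ Finset.range (max N (n + 1)), (n.choose k : ℚ) * c k := by
    refine Finset.sum_subset (Finset.range_mono (le_max_right _ _)) fun k _ hk => ?_
    rw [Nat.choose_eq_zero_of_lt (by simpa using hk), Nat.cast_zero, zero_mul]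
  have hR : ∑ k ∈ Finset.range N, c k * (n.choose k : ℚ) =
      ∑ k ∈ Finset.range (max N (n + 1)), c k * (n.choose k : ℚ) := by
    refine Finset.sum_subset (Finset.range_mono (le_max_left _ _)) fun k _ hk => ?_
    rw [hc0 k (by simpa using hk), zero_mul]
  rw [hL, hR]
  exact Finset.sum_congr rfl fun k _ => mul_comm _ _
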